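/- (Jackson's terminating ₈φ₇ sum) Let n be a nonnegative integer, let q, s, b, c, d be nonzero complex numbers, write a = s², and set e := a² q^{n+1}/(bcd) (so that a²q = bcde·q^{-n}). Assume (q;q)_n ≠ 0, (s;q)_n ≠ 0, (−s;q)_n ≠ 0, (aq/b;q)_n ≠ 0, (aq/c;q)_n ≠ 0, (aq/d;q)_n ≠ 0, (aq/e;q)_n ≠ 0, (aq^{n+1};q)_n ≠ 0, and (aq/(bcd);q)_n ≠ 0. Then ∑_{j=0}^{n} ((a;q)_j (qs;q)_j (−qs;q)_j (b;q)_j (c;q)_j (d;q)_j (e;q)_j (q^{-n};q)_j / ((q;q)_j (s;q)_j (−s;q)_j (aq/b;q)_j (aq/c;q)_j (aq/d;q)_j (aq/e;q)_j (aq^{n+1};q)_j)) · q^j = (aq;q)_n (aq/(bc);q)_n (aq/(bd);q)_n (aq/(cd);q)_n / ((aq/b;q)_n (aq/c;q)_n (aq/d;q)_n (aq/(bcd);q)_n). -/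

import Mathlib

/-- The $q$-shifted factorial $(a;q)_m = \prod_{k=0}^{m-1}(1 - a q^k)$. -/
noncomputable def qPoch (q a : ℂ) (m : ℕ) : ℂ := ∏ k ∈ Finset.range m, (1 - a * q ^ k)

theorem qPoch_zero (q a : ℂ) : qPoch q a 0 = 1 := by
  simp [qPoch]

theorem qPoch_succ (q a : ℂ) (m : ℕ) : qPoch q a (m + 1) = qPoch q a m * (1 - a * q ^ m) :=
  Finset.prod_range_succ _ _

theorem qPoch_succ' (q a : ℂ) (m : ℕ) :
    qPoch q a (m + 1) = (1 - a) * qPoch q (a * q) m := by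
  rw [qPoch, Finset.prod_range_succ', mul_comm]
  simp [qPoch, pow_succ', mul_assoc]

theorem qPoch_ne_zero_iff {q a : ℂ} {m : ℕ} :
    qPoch q a m ≠ 0 ↔ ∀ k < m, 1 - a * q ^ k ≠ 0 := by
  simp [qPoch, Finset.prod_ne_zero_iff]

theorem qPoch_ne_zero_of_le {q a : ℂ} {m n : ℕ} (hmn : m ≤ n) (h : qPoch q a n ≠ 0) :
    qPoch q a m ≠ 0 :=
  qPoch_ne_zero_iff.2 fun k hk => qPoch_ne_zero_iff.1 h k (hk.trans_le hmn)

theorem continuousAt_qPoch {q a₀ : ℂ} {f : ℂ → ℂ} (hf : ContinuousAt f a₀) (m : ℕ) :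
    ContinuousAt (fun a => qPoch q (f a) m) a₀ := by
  unfold qPoch
  fun_prop

/-- The summand of Jackson's sum, as a function of `a` rather than of a square root of `a`. -/
noncomputable def jacksonTerm (q a b c d : ℂ) (n j : ℕ) : ℂ :=
  (1 - a * (q ^ j) ^ 2) * q ^ j *
    (qPoch q a j * qPoch q b j * qPoch q c j * qPoch q d j *
      qPoch q (a ^ 2 * q ^ (n + 1) / (b * c * d)) j * qPoch q (q ^ n)⁻¹ j) /
    ((1 - a) * (qPoch q q j * qPoch q (a * q / b) j * qPoch q (a * q / c) j *
      qPoch q (a * q / d) j * qPoch q (b * c * d / (a * q ^ n)) j *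
      qPoch q (a * q ^ (n + 1)) j))

/-- The product side of Jackson's sum. -/
noncomputable def jacksonProd (q a b c d : ℂ) (n : ℕ) : ℂ :=
  qPoch q (a * q) n * qPoch q (a * q / (b * c)) n *
    qPoch q (a * q / (b * d)) n * qPoch q (a * q / (c * d)) n /
    (qPoch q (a * q / b) n * qPoch q (a * q / c) n *
      qPoch q (a * q / d) n * qPoch q (a * q / (b * c * d)) n)

/-- The ratio of consecutive values of `jacksonProd`, with `X = q ^ (n + 1)`. -/
noncomputable def jacksonRatio (a b c d X : ℂ) : ℂ :=
  (1 - a * X) * ((1 - a * X / (b * c)) * (1 - a * X / (b * d)) * (1 - a * X / (c * d))) /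
    ((1 - a * X / b) * (1 - a * X / c) * (1 - a * X / d) * (1 - a * X / (b * c * d)))

theorem jacksonProd_succ (q a b c d : ℂ) (n : ℕ) :
    jacksonProd q a b c d (n + 1) =
      jacksonRatio a b c d (q ^ (n + 1)) * jacksonProd q a b c d n := by
  have h (x : ℂ) : a * q / x * q ^ n = a * q ^ (n + 1) / x := by ring
  have h' : a * q * q ^ n = a * q ^ (n + 1) := by ring
  simp only [jacksonProd, jacksonRatio, qPoch_succ, h, h']
  rw [div_mul_div_comm]
  congr 1 <;> ring

/-- The Wilf–Zeilberger antidifference for Jackson's sum, up to the factor `1 - jacksonRatio`. -/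
noncomputable def jacksonCert (q a b c d : ℂ) (n m : ℕ) : ℂ :=
  qPoch q (a * q) m * qPoch q (b * q) m * qPoch q (c * q) m * qPoch q (d * q) m *
      qPoch q (a ^ 2 * q ^ (n + 2) / (b * c * d)) m * qPoch q (q ^ n)⁻¹ m /
    (qPoch q q m * qPoch q (a * q / b) m * qPoch q (a * q / c) m *
      qPoch q (a * q / d) m * qPoch q (b * c * d / (a * q ^ n)) m *
      qPoch q (a * q ^ (n + 2)) m)

theorem jackson_poly_ratio (a b c d X : ℂ) (hb : b ≠ 0) (hc : c ≠ 0) (hd : d ≠ 0) :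
    (1 - a * X / b) * (1 - a * X / c) * (1 - a * X / d) * (1 - a * X / (b * c * d)) -
      (1 - a * X) * ((1 - a * X / (b * c)) * (1 - a * X / (b * d)) * (1 - a * X / (c * d))) =
    -(a * X / (b * c * d)) * ((1 - b) * (1 - c) * (1 - d)) *
      (1 - a ^ 2 * X ^ 2 / (b * c * d)) := by
  field_simp
  ring

theorem jackson_poly_step (a b c d X J : ℂ) (ha : a ≠ 0) (hb : b ≠ 0) (hc : c ≠ 0) (hd : d ≠ 0)
    (hX : X ≠ 0) :
    (1 - a * J ^ 2) * J * (-(a * X / (b * c * d)) *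
        ((1 - a * X / b) * (1 - a * X / c) * (1 - a * X / d)) *
        (1 - a ^ 2 * X / (b * c * d) * J) * (1 - X⁻¹) * (1 - b * c * d / (a * X) * J) -
      (1 - a * X / (b * c)) * (1 - a * X / (b * d)) * (1 - a * X / (c * d)) *
        (1 - a ^ 2 * X / (b * c * d)) * (1 - J / X) * (1 - a * X * J)) =
    -(a * X / (b * c * d)) * (1 - a ^ 2 * X ^ 2 / (b * c * d)) *
      ((1 - a * J) * (1 - b * J) * (1 - c * J) * (1 - d * J) *
        (1 - a ^ 2 * X / (b * c * d) * J) * (1 - J / X) -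
      (1 - J) * (1 - a * J / b) * (1 - a * J / c) * (1 - a * J / d) *
        (1 - b * c * d / (a * X) * J) * (1 - a * X * J)) := by
  field_simp
  ring

theorem jackson_rat_step (a b c d X J : ℂ) (ha : a ≠ 0) (hb : b ≠ 0) (hc : c ≠ 0) (hd : d ≠ 0)
    (hX : X ≠ 0) (h1 : 1 - a * X / b ≠ 0) (h2 : 1 - a * X / c ≠ 0) (h3 : 1 - a * X / d ≠ 0)
    (h4 : 1 - a * X / (b * c * d) ≠ 0) (h5 : 1 - a * X ≠ 0) (h6 : 1 - a * X * J ≠ 0)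
    (h7 : 1 - b * c * d / (a * X) * J ≠ 0) (h8 : 1 - J ≠ 0) (h9 : 1 - a * J / b ≠ 0)
    (h10 : 1 - a * J / c ≠ 0) (h11 : 1 - a * J / d ≠ 0) :
    (1 - a * J ^ 2) * J * ((1 - b) * (1 - c) * (1 - d) *
        (1 - a ^ 2 * X / (b * c * d) * J) * (1 - X⁻¹)) /
      ((1 - J) * (1 - a * J / b) * (1 - a * J / c) * (1 - a * J / d) *
        (1 - b * c * d / (a * X)) * (1 - a * X * J)) -
    jacksonRatio a b c d X * ((1 - a * J ^ 2) * J * ((1 - b) * (1 - c) * (1 - d) *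
        (1 - a ^ 2 * X / (b * c * d)) * (1 - J / X)) /
      ((1 - J) * (1 - a * J / b) * (1 - a * J / c) * (1 - a * J / d) *
        (1 - b * c * d / (a * X) * J) * (1 - a * X))) =
    (1 - jacksonRatio a b c d X) *
      ((1 - a * J) * (1 - b * J) * (1 - c * J) * (1 - d * J) *
        (1 - a ^ 2 * X / (b * c * d) * J) * (1 - J / X) /
      ((1 - J) * (1 - a * J / b) * (1 - a * J / c) * (1 - a * J / d) *
        (1 - b * c * d / (a * X) * J) * (1 - a * X * J)) - 1) := by
  have key1 := jackson_poly_ratio a b c d X hb hc hd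
  have key2 := jackson_poly_step a b c d X J ha hb hc hd hX
  have hκ : a * X / (b * c * d) ≠ 0 := by positivity
  have hw : 1 - b * c * d / (a * X) = -(1 - a * X / (b * c * d)) / (a * X / (b * c * d)) := by
    field_simp
    ring
  rw [hw, jacksonRatio]
  generalize a * X / (b * c * d) = κ at *
  generalize 1 - b * c * d / (a * X) * J = W at *
  generalize (1 - a * X / (b * c)) * (1 - a * X / (b * d)) * (1 - a * X / (c * d)) = N at *
  generalize 1 - a ^ 2 * X / (b * c * d) * J = e₁ at *
  generalize 1 - a ^ 2 * X / (b * c * d) = e₂ at *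
  generalize 1 - a ^ 2 * X ^ 2 / (b * c * d) = e₃ at *
  generalize (1 - a * J) * (1 - b * J) * (1 - c * J) * (1 - d * J) = Q at *
  generalize 1 - a * X / b = D₁ at *
  generalize 1 - a * X / c = D₂ at *
  generalize 1 - a * X / d = D₃ at *
  generalize 1 - κ = D₄ at *
  generalize 1 - a * J / b = E₁ at *
  generalize 1 - a * J / c = E₂ at *
  generalize 1 - a * J / d = E₃ at *
  generalize 1 - J = E₄ at *
  generalize 1 - a * X * J = Y at *
  generalize 1 - a * X = Z at *
  generalize (1 - a * J ^ 2) * J = p at *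
  generalize (1 - b) * (1 - c) * (1 - d) = B at *
  generalize 1 - J / X = V at *
  generalize 1 - X⁻¹ = U at *
  have hr : 1 - Z * N / (D₁ * D₂ * D₃ * D₄) = -κ * B * e₃ / (D₁ * D₂ * D₃ * D₄) := by
    rw [← key1]
    field_simp
  rw [hr]
  field_simp
  linear_combination B * key2

theorem jackson_sum_sub_ratio_mul (q a b c d : ℂ) (n m : ℕ) (hm : m ≤ n + 1) (hq : q ≠ 0)
    (ha : a ≠ 0) (hb : b ≠ 0) (hc : c ≠ 0) (hd : d ≠ 0) (h1 : qPoch q q (n + 1) ≠ 0)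
    (ga : ∀ k : ℕ, 1 - a * q ^ k ≠ 0) (gb : ∀ k : ℕ, 1 - a * q ^ k / b ≠ 0)
    (gc : ∀ k : ℕ, 1 - a * q ^ k / c ≠ 0) (gd : ∀ k : ℕ, 1 - a * q ^ k / d ≠ 0)
    (gt : ∀ k : ℕ, 1 - a * q ^ k / (b * c * d) ≠ 0)
    (gw : ∀ k l : ℕ, 1 - b * c * d / (a * q ^ k) * q ^ l ≠ 0) :
    ∑ j ∈ Finset.range (m + 1), (jacksonTerm q a b c d (n + 1) j -
        jacksonRatio a b c d (q ^ (n + 1)) * jacksonTerm q a b c d n j) =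
      (1 - jacksonRatio a b c d (q ^ (n + 1))) * jacksonCert q a b c d n m := by
  have ga0 : 1 - a ≠ 0 := by simpa using ga 0
  induction m with
  | zero => simp [jacksonTerm, jacksonCert, qPoch_zero, ga0]
  | succ m ih =>
    rw [Finset.sum_range_succ, ih (by omega)]
    have hqm : ∀ k < n + 1, 1 - q ^ (k + 1) ≠ 0 := fun k hk => by
      simpa [pow_succ'] using qPoch_ne_zero_iff.1 h1 k hk
    have step := jackson_rat_step a b c d (q ^ (n + 1)) (q ^ (m + 1)) ha hb hc hd
      (pow_ne_zero _ hq) (gb _) (gc _) (gd _) (gt _) (ga _)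
      (by simpa [mul_assoc, ← pow_add] using ga (n + 1 + (m + 1))) (gw _ _) (hqm m (by omega))
      (gb _) (gc _) (gd _)
    have e1 : jacksonTerm q a b c d (n + 1) (m + 1) = jacksonCert q a b c d n m *
        ((1 - a * (q ^ (m + 1)) ^ 2) * q ^ (m + 1) * ((1 - b) * (1 - c) * (1 - d) *
        (1 - a ^ 2 * q ^ (n + 1) / (b * c * d) * q ^ (m + 1)) * (1 - (q ^ (n + 1))⁻¹)) /
      ((1 - q ^ (m + 1)) * (1 - a * q ^ (m + 1) / b) * (1 - a * q ^ (m + 1) / c) *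
        (1 - a * q ^ (m + 1) / d) *
        (1 - b * c * d / (a * q ^ (n + 1))) * (1 - a * q ^ (n + 1) * q ^ (m + 1)))) := by
      have s1 (x : ℂ) : a * q / x * q ^ m = a * q ^ (m + 1) / x := by ring
      have s2 : b * c * d / (a * q ^ (n + 1)) * q = b * c * d / (a * q ^ n) := by
        field_simp
        ring
      have s3 : (q ^ (n + 1))⁻¹ * q = (q ^ n)⁻¹ := by
        field_simp
        ring
      have s4 : q * q ^ m = q ^ (m + 1) := by ring
      have s5 : a ^ 2 * q ^ (n + 1 + 1) / (b * c * d) * q ^ m =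
        a ^ 2 * q ^ (n + 1) / (b * c * d) * q ^ (m + 1) := by ring
      have s6 : a * q ^ (n + 1 + 1) * q ^ m = a * q ^ (n + 1) * q ^ (m + 1) := by ring
      rw [jacksonTerm, jacksonCert, qPoch_succ' q a, qPoch_succ' q b, qPoch_succ' q c,
        qPoch_succ' q d, qPoch_succ' q (q ^ (n + 1))⁻¹, qPoch_succ' q (b * c * d / _),
        qPoch_succ q q, qPoch_succ q (a * q / b), qPoch_succ q (a * q / c),
        qPoch_succ q (a * q / d), qPoch_succ q (a ^ 2 * _ / _), qPoch_succ q (a * q ^ (n + 1 + 1)),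
        s1, s1, s1, s2, s3, s4, s5, s6, div_mul_div_comm]
      conv_rhs => rw [← mul_div_mul_left _ _ ga0]
      congr 1 <;> ac_rfl
    have e2 : jacksonTerm q a b c d n (m + 1) = jacksonCert q a b c d n m *
        ((1 - a * (q ^ (m + 1)) ^ 2) * q ^ (m + 1) * ((1 - b) * (1 - c) * (1 - d) *
        (1 - a ^ 2 * q ^ (n + 1) / (b * c * d)) * (1 - q ^ (m + 1) / q ^ (n + 1))) /
      ((1 - q ^ (m + 1)) * (1 - a * q ^ (m + 1) / b) * (1 - a * q ^ (m + 1) / c) *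
        (1 - a * q ^ (m + 1) / d) *
        (1 - b * c * d / (a * q ^ (n + 1)) * q ^ (m + 1)) * (1 - a * q ^ (n + 1)))) := by
      have s1 (x : ℂ) : a * q / x * q ^ m = a * q ^ (m + 1) / x := by ring
      have s2 : b * c * d / (a * q ^ n) * q ^ m =
          b * c * d / (a * q ^ (n + 1)) * q ^ (m + 1) := by
        field_simp
        ring
      have s3 : (q ^ n)⁻¹ * q ^ m = q ^ (m + 1) / q ^ (n + 1) := by
        field_simp
        ring
      have s4 : q * q ^ m = q ^ (m + 1) := by ring
      have s5 : a ^ 2 * q ^ (n + 1) / (b * c * d) * q =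
        a ^ 2 * q ^ (n + 2) / (b * c * d) := by ring
      have s6 : a * q ^ (n + 1) * q = a * q ^ (n + 2) := by ring
      rw [jacksonTerm, jacksonCert, qPoch_succ' q a, qPoch_succ' q b, qPoch_succ' q c,
        qPoch_succ' q d, qPoch_succ q (q ^ n)⁻¹, qPoch_succ q (b * c * d / _),
        qPoch_succ q q, qPoch_succ q (a * q / b), qPoch_succ q (a * q / c),
        qPoch_succ q (a * q / d), qPoch_succ' q (a ^ 2 * _ / _), qPoch_succ' q (a * q ^ (n + 1)),
        s1, s1, s1, s2, s3, s4, s5, s6, div_mul_div_comm]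
      conv_rhs => rw [← mul_div_mul_left _ _ ga0]
      congr 1 <;> ac_rfl
    have e3 : jacksonCert q a b c d n (m + 1) = jacksonCert q a b c d n m *
        ((1 - a * q ^ (m + 1)) * (1 - b * q ^ (m + 1)) * (1 - c * q ^ (m + 1)) *
        (1 - d * q ^ (m + 1)) *
        (1 - a ^ 2 * q ^ (n + 1) / (b * c * d) * q ^ (m + 1)) *
        (1 - q ^ (m + 1) / q ^ (n + 1)) /
      ((1 - q ^ (m + 1)) * (1 - a * q ^ (m + 1) / b) * (1 - a * q ^ (m + 1) / c) *
        (1 - a * q ^ (m + 1) / d) *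
        (1 - b * c * d / (a * q ^ (n + 1)) * q ^ (m + 1)) *
        (1 - a * q ^ (n + 1) * q ^ (m + 1)))) := by
      have s1 (x : ℂ) : a * q / x * q ^ m = a * q ^ (m + 1) / x := by ring
      have s2 : b * c * d / (a * q ^ n) * q ^ m =
          b * c * d / (a * q ^ (n + 1)) * q ^ (m + 1) := by
        field_simp
        ring
      have s3 : (q ^ n)⁻¹ * q ^ m = q ^ (m + 1) / q ^ (n + 1) := by
        field_simp
        ring
      have s4 (x : ℂ) : x * q * q ^ m = x * q ^ (m + 1) := by ring
      have s4' : q * q ^ m = q ^ (m + 1) := by ring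
      have s5 : a ^ 2 * q ^ (n + 2) / (b * c * d) * q ^ m =
        a ^ 2 * q ^ (n + 1) / (b * c * d) * q ^ (m + 1) := by ring
      have s6 : a * q ^ (n + 2) * q ^ m = a * q ^ (n + 1) * q ^ (m + 1) := by ring
      simp only [jacksonCert, qPoch_succ]
      rw [s1, s1, s1, s2, s3, s4, s4, s4, s4, s4', s5, s6, div_mul_div_comm]
      congr 1 <;> ac_rfl
    rw [e1, e2, e3]
    linear_combination jacksonCert q a b c d n m * step

theorem qPoch_inv_pow_eq_zero {q : ℂ} (hq : q ≠ 0) (n : ℕ) :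
    qPoch q (q ^ n)⁻¹ (n + 1) = 0 := by
  rw [qPoch_succ, inv_mul_cancel₀ (pow_ne_zero n hq), sub_self, mul_zero]

theorem jackson_sum_of_generic (q a b c d : ℂ) (n : ℕ) (hq : q ≠ 0)
    (ha : a ≠ 0) (hb : b ≠ 0) (hc : c ≠ 0) (hd : d ≠ 0) (h1 : qPoch q q n ≠ 0)
    (ga : ∀ k : ℕ, 1 - a * q ^ k ≠ 0) (gb : ∀ k : ℕ, 1 - a * q ^ k / b ≠ 0)
    (gc : ∀ k : ℕ, 1 - a * q ^ k / c ≠ 0) (gd : ∀ k : ℕ, 1 - a * q ^ k / d ≠ 0)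
    (gt : ∀ k : ℕ, 1 - a * q ^ k / (b * c * d) ≠ 0)
    (gw : ∀ k l : ℕ, 1 - b * c * d / (a * q ^ k) * q ^ l ≠ 0) :
    ∑ j ∈ Finset.range (n + 1), jacksonTerm q a b c d n j = jacksonProd q a b c d n := by
  induction n with
  | zero =>
    have ga0 : 1 - a ≠ 0 := by simpa using ga 0
    simp [jacksonTerm, jacksonProd, qPoch_zero, ga0]
  | succ n ih =>
    have key := jackson_sum_sub_ratio_mul q a b c d n (n + 1) le_rfl hq ha hb hc hd h1
      ga gb gc gd gt gw
    have hcert : jacksonCert q a b c d n (n + 1) = 0 := by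
      simp [jacksonCert, qPoch_inv_pow_eq_zero hq]
    have hterm : jacksonTerm q a b c d n (n + 1) = 0 := by
      simp [jacksonTerm, qPoch_inv_pow_eq_zero hq]
    rw [Finset.sum_sub_distrib, ← Finset.mul_sum,
      Finset.sum_range_succ (jacksonTerm q a b c d n), hterm, hcert, add_zero,
      ih (qPoch_ne_zero_of_le n.le_succ h1), ← jacksonProd_succ, mul_zero, sub_eq_zero] at key
    exact key

theorem jackson_sum (q a b c d : ℂ) (n : ℕ) (hq : q ≠ 0)
    (ha : a ≠ 0) (hb : b ≠ 0) (hc : c ≠ 0) (hd : d ≠ 0) (ha1 : 1 - a ≠ 0)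
    (h1 : qPoch q q n ≠ 0)
    (h4 : qPoch q (a * q / b) n ≠ 0) (h5 : qPoch q (a * q / c) n ≠ 0)
    (h6 : qPoch q (a * q / d) n ≠ 0) (h7 : qPoch q (b * c * d / (a * q ^ n)) n ≠ 0)
    (h8 : qPoch q (a * q ^ (n + 1)) n ≠ 0)
    (h9 : qPoch q (a * q / (b * c * d)) n ≠ 0) :
    ∑ j ∈ Finset.range (n + 1), jacksonTerm q a b c d n j = jacksonProd q a b c d n := by
  let T : Set ℂ := ⋃ x ∈ ({0, 1, b, c, d, b * c * d} : Set ℂ), Set.range fun k : ℤ => x * q ^ k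
  have hT : T.Countable :=
    (Set.Finite.countable (by simp)).biUnion fun x _ => Set.countable_range _
  have hne : (nhdsWithin a Tᶜ).NeBot :=
    mem_closure_iff_nhdsWithin_neBot.1 ((hT.dense_compl ℝ).closure_eq ▸ Set.mem_univ a)
  have hmem (x y : ℂ) (hx : x ∈ ({0, 1, b, c, d, b * c * d} : Set ℂ)) (hy : y ∈ Tᶜ) (k : ℤ) :
      y ≠ x * q ^ k := fun h => hy (Set.mem_biUnion hx ⟨k, h.symm⟩)
  have hgen (y : ℂ) (hy : y ∈ Tᶜ) :
      ∑ j ∈ Finset.range (n + 1), jacksonTerm q y b c d n j = jacksonProd q y b c d n := by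
    have hdiv (x : ℂ) (hx : x ∈ ({0, 1, b, c, d, b * c * d} : Set ℂ)) (hx0 : x ≠ 0) (k : ℕ) :
        1 - y * q ^ k / x ≠ 0 := fun h => by
      refine hmem x y hx hy (-k) ?_
      rw [sub_eq_zero, eq_div_iff hx0, one_mul] at h
      rw [h, zpow_neg, zpow_natCast, mul_inv_cancel_right₀ (pow_ne_zero k hq)]
    have hy0 : y ≠ 0 := by simpa using hmem 0 y (by simp) hy 0
    refine jackson_sum_of_generic q y b c d n hq hy0 hb hc hd h1
      (by simpa using hdiv 1 (by simp) one_ne_zero)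
      (hdiv b (by simp) hb) (hdiv c (by simp) hc) (hdiv d (by simp) hd)
      (hdiv _ (by simp) (by positivity)) fun k l h => ?_
    refine hmem (b * c * d) y (by simp) hy (l - k) ?_
    rw [zpow_sub₀ hq, zpow_natCast, zpow_natCast]
    field_simp at h ⊢
    linear_combination h
  have hL : ContinuousAt (fun y => ∑ j ∈ Finset.range (n + 1), jacksonTerm q y b c d n j) a := by
    refine tendsto_finsetSum _ fun j hj => ?_
    have hjn : j ≤ n := Nat.lt_succ_iff.1 (Finset.mem_range.1 hj)
    unfold jacksonTerm
    refine ContinuousAt.div ?_ ?_ ?_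
    · have := continuousAt_qPoch (q := q) (a₀ := a) (f := fun y => y) (by fun_prop) j
      have := continuousAt_qPoch (q := q) (a₀ := a)
        (f := fun y => y ^ 2 * q ^ (n + 1) / (b * c * d)) (by fun_prop) j
      fun_prop
    · have hn : a * q ^ n ≠ 0 := mul_ne_zero ha (pow_ne_zero n hq)
      have := continuousAt_qPoch (q := q) (a₀ := a) (f := fun y => y * q / b) (by fun_prop) j
      have := continuousAt_qPoch (q := q) (a₀ := a) (f := fun y => y * q / c) (by fun_prop) j
      have := continuousAt_qPoch (q := q) (a₀ := a) (f := fun y => y * q / d) (by fun_prop) j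
      have := continuousAt_qPoch (q := q) (a₀ := a)
        (f := fun y => b * c * d / (y * q ^ n)) (by fun_prop (disch := exact hn)) j
      have := continuousAt_qPoch (q := q) (a₀ := a)
        (f := fun y => y * q ^ (n + 1)) (by fun_prop) j
      fun_prop
    · simp only [ne_eq, mul_eq_zero, not_or]
      exact ⟨ha1, ⟨⟨⟨⟨qPoch_ne_zero_of_le hjn h1, qPoch_ne_zero_of_le hjn h4⟩,
        qPoch_ne_zero_of_le hjn h5⟩, qPoch_ne_zero_of_le hjn h6⟩,
        qPoch_ne_zero_of_le hjn h7⟩, qPoch_ne_zero_of_le hjn h8⟩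
  have hR : ContinuousAt (fun y => jacksonProd q y b c d n) a := by
    have hx (x : ℂ) := continuousAt_qPoch (q := q) (a₀ := a)
      (f := fun y => y * q / x) (by fun_prop) n
    have := continuousAt_qPoch (q := q) (a₀ := a) (f := fun y => y * q) (by fun_prop) n
    unfold jacksonProd
    refine ContinuousAt.div ?_ ?_ ?_
    · exact ((this.mul (hx _)).mul (hx _)).mul (hx _)
    · exact (((hx _).mul (hx _)).mul (hx _)).mul (hx _)
    · simp only [ne_eq, mul_eq_zero, not_or]
      exact ⟨⟨⟨h4, h5⟩, h6⟩, h9⟩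
  refine tendsto_nhds_unique (l := nhdsWithin a Tᶜ) (hL.mono_left nhdsWithin_le_nhds)
    ((hR.mono_left nhdsWithin_le_nhds).congr' ?_)
  filter_upwards [self_mem_nhdsWithin] with y hy using (hgen y hy).symm

theorem one_sub_mul_qPoch_mul (q s : ℂ) (j : ℕ) :
    (1 - s) * qPoch q (q * s) j = qPoch q s j * (1 - s * q ^ j) := by
  rw [← qPoch_succ, qPoch_succ', mul_comm q s]

/-- Jackson's terminating ${}_8\phi_7$ sum, with $a = s^2$ and
$e = a^2 q^{n+1}/(bcd)$ (so that $a^2 q = bcde \, q^{-n}$). -/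
theorem jackson_8phi7 (n : ℕ) (q s b c d e : ℂ)
    (hq : q ≠ 0) (hs : s ≠ 0) (hb : b ≠ 0) (hc : c ≠ 0) (hd : d ≠ 0)
    (he : e = (s ^ 2) ^ 2 * q ^ (n + 1) / (b * c * d))
    (h1 : qPoch q q n ≠ 0) (h2 : qPoch q s n ≠ 0) (h3 : qPoch q (-s) n ≠ 0)
    (h4 : qPoch q (s ^ 2 * q / b) n ≠ 0) (h5 : qPoch q (s ^ 2 * q / c) n ≠ 0)
    (h6 : qPoch q (s ^ 2 * q / d) n ≠ 0) (h7 : qPoch q (s ^ 2 * q / e) n ≠ 0)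
    (h8 : qPoch q (s ^ 2 * q ^ (n + 1)) n ≠ 0)
    (h9 : qPoch q (s ^ 2 * q / (b * c * d)) n ≠ 0) :
    ∑ j ∈ Finset.range (n + 1),
      qPoch q (s ^ 2) j * qPoch q (q * s) j * qPoch q (-(q * s)) j * qPoch q b j *
        qPoch q c j * qPoch q d j * qPoch q e j * qPoch q (q ^ (-(n : ℤ))) j /
        (qPoch q q j * qPoch q s j * qPoch q (-s) j * qPoch q (s ^ 2 * q / b) j *
          qPoch q (s ^ 2 * q / c) j * qPoch q (s ^ 2 * q / d) j * qPoch q (s ^ 2 * q / e) j *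
          qPoch q (s ^ 2 * q ^ (n + 1)) j) * q ^ j
    = qPoch q (s ^ 2 * q) n * qPoch q (s ^ 2 * q / (b * c)) n *
        qPoch q (s ^ 2 * q / (b * d)) n * qPoch q (s ^ 2 * q / (c * d)) n /
        (qPoch q (s ^ 2 * q / b) n * qPoch q (s ^ 2 * q / c) n *
          qPoch q (s ^ 2 * q / d) n * qPoch q (s ^ 2 * q / (b * c * d)) n) := by
  obtain rfl | hn := n.eq_zero_or_pos
  · simp [qPoch_zero]
  have hs1 : 1 - s ≠ 0 := by simpa using qPoch_ne_zero_iff.1 h2 0 hn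
  have hs2 : 1 - -s ≠ 0 := by simpa using qPoch_ne_zero_iff.1 h3 0 hn
  have ha1 : 1 - s ^ 2 ≠ 0 := by
    rw [show 1 - s ^ 2 = (1 - s) * (1 - -s) by ring]
    exact mul_ne_zero hs1 hs2
  have hv : s ^ 2 * q / e = b * c * d / (s ^ 2 * q ^ n) := by
    rw [he]
    field_simp
    ring
  rw [hv] at h7 ⊢
  refine Eq.trans (Finset.sum_congr rfl fun j hj => ?_) (jackson_sum q (s ^ 2) b c d n hq
    (pow_ne_zero 2 hs) hb hc hd ha1 h1 h4 h5 h6 h7 h8 h9)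
  have hjn : j ≤ n := Nat.lt_succ_iff.1 (Finset.mem_range.1 hj)
  have hp1 : qPoch q (q * s) j = qPoch q s j * (1 - s * q ^ j) / (1 - s) := by
    rw [eq_div_iff hs1, mul_comm, one_sub_mul_qPoch_mul]
  have hp2 : qPoch q (-(q * s)) j = qPoch q (-s) j * (1 - -s * q ^ j) / (1 - -s) := by
    rw [eq_div_iff hs2, mul_comm, ← mul_neg, one_sub_mul_qPoch_mul]
  have hs1' := qPoch_ne_zero_of_le hjn h2
  have hs2' := qPoch_ne_zero_of_le hjn h3
  have := qPoch_ne_zero_of_le hjn h1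
  have := qPoch_ne_zero_of_le hjn h4
  have := qPoch_ne_zero_of_le hjn h5
  have := qPoch_ne_zero_of_le hjn h6
  have := qPoch_ne_zero_of_le hjn h7
  have := qPoch_ne_zero_of_le hjn h8
  rw [hp1, hp2, jacksonTerm, ← he, zpow_neg, zpow_natCast,
    show 1 - s ^ 2 = (1 - s) * (1 - -s) by ring]
  generalize qPoch q s j = p₁ at *
  generalize qPoch q (-s) j = p₂ at *
  generalize qPoch q q j = p₃ at *
  generalize qPoch q (s ^ 2 * q / b) j = p₄ at *
  generalize qPoch q (s ^ 2 * q / c) j = p₅ at *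
  generalize qPoch q (s ^ 2 * q / d) j = p₆ at *
  generalize qPoch q (b * c * d / (s ^ 2 * q ^ n)) j = p₇ at *
  generalize qPoch q (s ^ 2 * q ^ (n + 1)) j = p₈ at *
  generalize qPoch q (q ^ n)⁻¹ j = p₉ at *
  field_simp
  ring
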